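/- For integers 0 ≤ i < n ≤ N and 0 ≤ M ≤ N, it holds that ∑_{x=0}^{i} C(M,x) C(N−M, n−x) = ∑_{k=M}^{N−n+i} C(k, i) C(N−k−1, n−i−1), where the right-hand sum is empty (equal to 0) when M > N−n+i. Equivalently, if X ~ HYP(n,M,N) and Y ~ ABC(i, n−i−1, N−n), then P(X ≤ i | M) = 1 − P(Y ≤ M−i−1 | i, n−i−1, N−n). -/

import Mathlib

/-- Moving one element from the second urn to the first changes the truncated Vandermonde sum
by a single product of binomial coefficients. -/
theorem sum_range_choose_mul_choose_succ (M K n i : ℕ) (hin : i < n) :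
    ∑ x ∈ Finset.range (i + 1), M.choose x * (K + 1).choose (n - x)
      = ∑ x ∈ Finset.range (i + 1), (M + 1).choose x * K.choose (n - x)
        + M.choose i * K.choose (n - i - 1) := by
  induction i with
  | zero =>
    obtain ⟨m, rfl⟩ : ∃ m, n = m + 1 := ⟨n - 1, by omega⟩
    simp [Nat.choose_succ_succ', add_comm]
  | succ i ih =>
    obtain ⟨d, rfl⟩ : ∃ d, n = i + 1 + (d + 1) := ⟨n - (i + 2), by omega⟩
    rw [Finset.sum_range_succ, Finset.sum_range_succ _ (i + 1), ih (by omega),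
      show i + 1 + (d + 1) - i - 1 = d + 1 by omega,
      show i + 1 + (d + 1) - (i + 1) = d + 1 by omega, Nat.add_sub_cancel,
      Nat.choose_succ_succ' M i, Nat.choose_succ_succ' K d]
    ring

/-- For `0 ≤ i < n ≤ N` and `0 ≤ M ≤ N`,
`∑_{x=0}^{i} C(M,x) C(N-M,n-x) = ∑_{k=M}^{N-n+i} C(k,i) C(N-k-1,n-i-1)`
(the right-hand sum being empty when `M > N - n + i`). -/
theorem hypergeometric_cdf_eq_sum (n N i M : ℕ) (hin : i < n) (hnN : n ≤ N) (hM : M ≤ N) :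
    ∑ x ∈ Finset.range (i + 1), M.choose x * (N - M).choose (n - x)
      = ∑ k ∈ Finset.Icc M (N - n + i), k.choose i * (N - k - 1).choose (n - i - 1) := by
  induction hM using Nat.decreasingInduction with
  | self =>
    rw [Finset.Icc_eq_empty (by omega), Finset.sum_empty]
    refine Finset.sum_eq_zero fun x hx => ?_
    rw [Finset.mem_range] at hx
    rw [Nat.choose_eq_zero_of_lt (by omega : N - N < n - x), mul_zero]
  | of_succ M hM ih =>
    rw [show N - M = N - (M + 1) + 1 by omega, sum_range_choose_mul_choose_succ _ _ _ _ hin, ih]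
    by_cases h : M ≤ N - n + i
    · rw [← Finset.insert_Icc_add_one_left_eq_Icc h, Finset.sum_insert (by simp), add_comm,
        Nat.sub_sub N M 1]
    · rw [Finset.Icc_eq_empty h, Finset.Icc_eq_empty (by omega),
        Nat.choose_eq_zero_of_lt (by omega : N - (M + 1) < n - i - 1)]
      simp
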